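/- For any δ > 0 and any Borel probability measure P on ℝ^d, the distributionally robust halfspace depth vanishes at infinity: D_δ(z|P) → 0 as ‖z‖ → ∞. -/

import Mathlib

open MeasureTheory RealInnerProductSpace
open scoped ENNReal

abbrev Ed (d : ℕ) := EuclideanSpace ℝ (Fin d)

/-- 1-Wasserstein distance between Borel measures on `ℝ^d`. -/
noncomputable def wassersteinDist {d : ℕ} (P Q : Measure (Ed d)) : ℝ≥0∞ :=
  ⨅ (π : Measure (Ed d × Ed d)) (_ : π.map Prod.fst = P) (_ : π.map Prod.snd = Q),
    ∫⁻ p, ENNReal.ofReal ‖p.1 - p.2‖ ∂π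

/-- Worst-case probability of a set over the Wasserstein ball of radius `δ` around `P`. -/
noncomputable def supProb {d : ℕ} (δ : ℝ) (P : Measure (Ed d)) (A : Set (Ed d)) : ℝ :=
  sSup {v : ℝ | ∃ Q : Measure (Ed d), IsProbabilityMeasure Q ∧
    wassersteinDist Q P ≤ ENNReal.ofReal δ ∧ v = (Q A).toReal}

/-- Distributionally robust halfspace depth. -/
noncomputable def robustDepth {d : ℕ} (δ : ℝ) (z : Ed d) (P : Measure (Ed d)) : ℝ :=
  sInf {v : ℝ | ∃ u : Ed d, ‖u‖ = 1 ∧ v = supProb δ P {x | 0 ≤ ⟪u, x - z⟫}}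

/-- If `Q` and `P` are at Wasserstein distance less than `c`, then the tail of `Q` is controlled by
the tail of `P` and Markov's inequality for the transport cost. -/
theorem measure_norm_ge_le_of_wassersteinDist_lt {d : ℕ} {P Q : Measure (Ed d)} {c : ℝ≥0∞}
    (h : wassersteinDist Q P < c) {r : ℝ} (hr : 0 < r) :
    Q {x | 2 * r ≤ ‖x‖} ≤ c / ENNReal.ofReal r + P {x | r < ‖x‖} := by
  simp only [wassersteinDist, iInf_lt_iff] at h
  obtain ⟨π, hQ, hP, hc⟩ := h
  have hsub : Prod.fst ⁻¹' {x : Ed d | 2 * r ≤ ‖x‖} ⊆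
      {p : Ed d × Ed d | ENNReal.ofReal r ≤ ENNReal.ofReal ‖p.1 - p.2‖} ∪
        Prod.snd ⁻¹' {x : Ed d | r < ‖x‖} := by
    intro p hp
    by_cases hp2 : r < ‖p.2‖
    · exact Or.inr hp2
    · refine Or.inl (ENNReal.ofReal_le_ofReal ?_)
      have hp1 : 2 * r ≤ ‖p.1‖ := hp
      linarith [norm_sub_norm_le p.1 p.2]
  have hmarkov : π {p | ENNReal.ofReal r ≤ ENNReal.ofReal ‖p.1 - p.2‖} ≤
      c / ENNReal.ofReal r :=
    (meas_ge_le_lintegral_div (by fun_prop) (by simpa using hr) ENNReal.ofReal_ne_top).trans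
      (ENNReal.div_le_div_right hc.le _)
  rw [← hQ, ← hP,
    Measure.map_apply measurable_fst (measurableSet_le measurable_const measurable_norm),
    Measure.map_apply measurable_snd (measurableSet_lt measurable_const measurable_norm)]
  exact (measure_mono hsub).trans ((measure_union_le _ _).trans (by gcongr))

theorem supProb_nonneg {d : ℕ} (δ : ℝ) (P : Measure (Ed d)) (A : Set (Ed d)) :
    0 ≤ supProb δ P A := by
  apply Real.sSup_nonneg
  rintro _ ⟨Q, -, -, rfl⟩
  exact ENNReal.toReal_nonneg

theorem robustDepth_nonneg {d : ℕ} (δ : ℝ) (z : Ed d) (P : Measure (Ed d)) :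
    0 ≤ robustDepth δ z P := by
  apply Real.sInf_nonneg
  rintro _ ⟨u, -, rfl⟩
  exact supProb_nonneg _ _ _

theorem robustDepth_le_supProb {d : ℕ} (δ : ℝ) (z : Ed d) (P : Measure (Ed d)) {u : Ed d}
    (hu : ‖u‖ = 1) : robustDepth δ z P ≤ supProb δ P {x | 0 ≤ ⟪u, x - z⟫} := by
  refine csInf_le ⟨0, ?_⟩ ⟨u, hu, rfl⟩
  rintro _ ⟨v, -, rfl⟩
  exact supProb_nonneg _ _ _

/-- The halfspace through `z` with outer normal `z` lies outside the open ball of radius `‖z‖`. -/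
theorem norm_le_norm_of_inner_normalize_nonneg {d : ℕ} {x z : Ed d} (hz : z ≠ 0)
    (hx : 0 ≤ ⟪‖z‖⁻¹ • z, x - z⟫) : ‖z‖ ≤ ‖x‖ := by
  have hpos : 0 < ‖z‖ := norm_pos_iff.2 hz
  rw [real_inner_smul_left, mul_nonneg_iff_of_pos_left (inv_pos.2 hpos), inner_sub_right,
    real_inner_self_eq_norm_sq, sub_nonneg] at hx
  have := real_inner_le_norm z x
  nlinarith

theorem ofReal_robustDepth_le {d : ℕ} {δ : ℝ} (hδ : 0 < δ) (P : Measure (Ed d)) {z : Ed d}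
    (hz : z ≠ 0) :
    ENNReal.ofReal (robustDepth δ z P) ≤
      ENNReal.ofReal (δ + 1) / ENNReal.ofReal (‖z‖ / 2) + P {x | ‖z‖ / 2 < ‖x‖} := by
  set b := ENNReal.ofReal (δ + 1) / ENNReal.ofReal (‖z‖ / 2) + P {x | ‖z‖ / 2 < ‖x‖}
  rcases eq_or_ne b ⊤ with hbt | hbt
  · simp [hbt]
  refine ENNReal.ofReal_le_of_le_toReal
    ((robustDepth_le_supProb δ z P (norm_smul_inv_norm (𝕜 := ℝ) hz)).trans ?_)
  refine Real.sSup_le ?_ ENNReal.toReal_nonneg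
  rintro _ ⟨Q, -, hQ, rfl⟩
  refine ENNReal.toReal_mono hbt (le_trans (measure_mono fun x hx => ?_)
    (measure_norm_ge_le_of_wassersteinDist_lt (c := ENNReal.ofReal (δ + 1)) ?_
      (half_pos (norm_pos_iff.2 hz))))
  · have := norm_le_norm_of_inner_normalize_nonneg hz hx
    simpa [mul_div_cancel₀] using this
  · exact hQ.trans_lt ((ENNReal.ofReal_lt_ofReal_iff (by linarith)).2 (by linarith))

/-- **Null at infinity (P2).** `D_δ(z|P) → 0` as `‖z‖ → ∞`. -/
theorem robustDepth_tendsto_zero_at_infty {d : ℕ} (δ : ℝ) (hδ : 0 < δ)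
    (P : Measure (Ed d)) [IsProbabilityMeasure P] :
    Filter.Tendsto (fun z : Ed d => robustDepth δ z P)
      (Filter.comap norm Filter.atTop) (nhds 0) := by
  have hhalf : Filter.Tendsto (fun z : Ed d => ‖z‖ / 2) (Filter.comap norm Filter.atTop)
      Filter.atTop := Filter.tendsto_comap.atTop_div_const two_pos
  have htail : Filter.Tendsto (fun r : ℝ => P {x | r < ‖x‖}) Filter.atTop (nhds 0) := by
    simpa using tendsto_measure_norm_gt_of_isTightMeasureSet
      (isTightMeasureSet_singleton (μ := P))
  have hcost : Filter.Tendsto (fun r : ℝ => ENNReal.ofReal (δ + 1) / ENNReal.ofReal r)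
      Filter.atTop (nhds 0) := by
    simpa using ENNReal.Tendsto.const_div ENNReal.tendsto_ofReal_atTop
      (Or.inr (ENNReal.ofReal_ne_top (r := δ + 1)))
  have hbound := (hcost.add htail).comp hhalf
  rw [add_zero] at hbound
  have hne : ∀ᶠ z : Ed d in Filter.comap norm Filter.atTop, z ≠ 0 :=
    (Filter.tendsto_comap.eventually (Filter.eventually_gt_atTop 0)).mono
      fun z hz => norm_pos_iff.1 hz
  have hlim := tendsto_of_tendsto_of_tendsto_of_le_of_le' tendsto_const_nhds hbound
    (Filter.Eventually.of_forall fun _ => zero_le)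
    (hne.mono fun z hz => ofReal_robustDepth_le hδ P hz)
  simpa [Function.comp_def, ENNReal.toReal_ofReal (robustDepth_nonneg _ _ _)] using
    (ENNReal.tendsto_toReal ENNReal.zero_ne_top).comp hlim
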